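/- arXiv:2509.17028 — 6 statements merged into one kernel-verified Lean document; each statement's English description precedes it below -/
import Mathlib

section
/- There exists a packetized non-preemptive strict priority system for which β(t) = c·max(t − L/c, 0) is not a service curve for the highest priority queue, where L is the maximum packet length of all lower priority queues. Concretely: let c > 0, L > 0 and l > 0, and suppose a lower-priority packet of length L starts transmission at time 0 and a highest-priority packet of length l arrives at time 0; under non-preemption the high-priority packet departs at time (L + l)/c, so for the high-priority flow A(t) = l for t > 0 and A(t) = 0 for t ≤ 0, while A*(t) = l for t > (L + l)/c and A*(t) = 0 for t ≤ (L + l)/c. Then for every t with L/c < t ≤ (L + l)/c, inf_{0 ≤ s ≤ t} { A(s) + c·max(t − s − L/c, 0) } = min(c·(t − L/c), l) > 0 = A*(t), so the service curve inequality fails for β(t) = c·max(t − L/c, 0). -/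
/-- For a packetized non-preemptive strict priority system where a
lower-priority packet of length `L` starts transmission at time 0 and a
highest-priority packet of length `l` arrives at time 0 (so it departs at
`(L + l)/c`), `β(t) = c·(t − L/c)⁺` is not a service curve of the highest
priority queue: for every `L/c < t ≤ (L + l)/c`,
`inf_{0 ≤ s ≤ t} (A(s) + c·(t − s − L/c)⁺) = min(c·(t − L/c), l) > 0 = A*(t)`. -/
theorem faulty_service_curve_SP
    (c L l : ℝ) (hc : 0 < c) (hL : 0 < L) (hl : 0 < l)
    (A Astar : ℝ → ℝ)
    (hA : ∀ t, A t = if 0 < t then l else 0)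
    (hAstar : ∀ t, Astar t = if (L + l) / c < t then l else 0) :
    ∀ t, L / c < t → t ≤ (L + l) / c →
      sInf ((fun s => A s + c * max (t - s - L / c) 0) '' Set.Icc 0 t)
        = min (c * (t - L / c)) l ∧
      0 < min (c * (t - L / c)) l ∧
      Astar t = 0 ∧
      Astar t < sInf ((fun s => A s + c * max (t - s - L / c) 0) '' Set.Icc 0 t) := by
  intro t ht htl
  have hLc : 0 < L / c := div_pos hL hc
  have hpos : 0 < min (c * (t - L / c)) l := lt_min (mul_pos hc (sub_pos.2 ht)) hl
  have hleast : IsLeast ((fun s => A s + c * max (t - s - L / c) 0) '' Set.Icc 0 t)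
      (min (c * (t - L / c)) l) := by
    constructor
    · rcases min_choice (c * (t - L / c)) l with h | h
      · refine ⟨0, ⟨le_rfl, by linarith⟩, ?_⟩
        simp [h, hA, max_eq_left (sub_pos.2 ht).le]
      · refine ⟨t, ⟨by linarith, le_rfl⟩, ?_⟩
        simp [h, hA, hLc.trans ht, hLc.le]
    · rintro _ ⟨s, ⟨hs, -⟩, rfl⟩
      simp only [hA]
      split_ifs with h
      · have := mul_nonneg hc.le (le_max_right (t - s - L / c) 0)
        exact (min_le_right _ _).trans (by linarith)
      · obtain rfl : s = 0 := by linarith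
        simp [max_eq_left (sub_pos.2 ht).le]
  have hout : Astar t = 0 := by rw [hAstar, if_neg htl.not_gt]
  rw [hleast.csInf_eq, hout]
  exact ⟨rfl, hpos, rfl, hpos⟩
end

section
/- The output bound derived from the faulty service curve c·t is incorrect: the output of a packetized constant bit rate server fed with a (l/τ)·t + σ constrained flow need not itself be constrained by (l/τ)·t + σ. Concretely: let c > 0, τ > 0 and σ > l > 0 satisfy l/τ < c and τ < σ/c. Packet n arrives at a(n) = (n − 1)·τ with length l(1) = σ and l(n) = l for n ≥ 2, and is served FIFO at constant rate c, i.e., with d(0) = 0 the departure times satisfy d(n) = max(a(n), d(n − 1)) + l(n)/c; the cumulative output is A*(t) = Σ_{n : d(n) < t} l(n). Then there exist s ≥ 0 and t ≥ 0 such that A*(s + t) − A*(s) > (l/τ)·t + σ; in particular, (l/τ)·t + σ is not an arrival curve of the output, even though it is an arrival curve of the input. -/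
/-- Departure times of a packetized work-conserving FIFO server of constant bit
rate `c`: `d(0) = 0` and `d(n+1) = max(a(n+1), d(n)) + l(n+1)/c`, where `a` gives
the times the packets become available and `len` their lengths. -/
noncomputable def dep (c : ℝ) (a len : ℕ → ℝ) : ℕ → ℝ
  | 0 => 0
  | n + 1 => max (a (n + 1)) (dep c a len n) + len (n + 1) / c

theorem le_dep_succ {c : ℝ} {a len : ℕ → ℝ} (hc : 0 < c) (hlen : ∀ n, 0 ≤ len n) (n : ℕ) :
    a (n + 1) ≤ dep c a len (n + 1) := by
  have h := div_nonneg (hlen (n + 1)) hc.le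
  have h' := le_max_left (a (n + 1)) (dep c a len n)
  simp only [dep]
  linarith

theorem dep_monotone {c : ℝ} {a len : ℕ → ℝ} (hc : 0 < c) (hlen : ∀ n, 0 ≤ len n) :
    Monotone (dep c a len) := by
  refine monotone_nat_of_le_succ fun n => ?_
  have h := div_nonneg (hlen (n + 1)) hc.le
  have h' := le_max_right (a (n + 1)) (dep c a len n)
  simp only [dep]
  linarith

/-- Cumulative function of a periodic packet flow whose first packet has length `σ` and whose
other packets have length `l`. -/
theorem tsum_periodic_arrivals {τ σ l t : ℝ} (hτ : 0 < τ) {a len : ℕ → ℝ}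
    (ha : ∀ n, a n = ((n : ℝ) - 1) * τ)
    (hlen0 : len 0 = 0) (hlen1 : len 1 = σ) (hlen : ∀ n, 2 ≤ n → len n = l) (ht : 0 < t) :
    (∑' n : ℕ, if a n < t then len n else 0) = σ + l * ((⌈t / τ⌉₊ : ℝ) - 1) := by
  have hpos : 0 < ⌈t / τ⌉₊ := Nat.ceil_pos.mpr (div_pos ht hτ)
  obtain ⟨N, hN⟩ := Nat.exists_eq_succ_of_ne_zero hpos.ne'
  have key : ∀ k : ℕ, a (k + 1) < t ↔ k < ⌈t / τ⌉₊ := by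
    intro k
    rw [ha, Nat.lt_ceil, lt_div_iff₀ hτ]
    push_cast
    simp
  rw [tsum_eq_sum (s := Finset.range (⌈t / τ⌉₊ + 1))]
  · rw [Finset.sum_range_succ', hN, Finset.sum_range_succ']
    have h : ∀ k ∈ Finset.range N,
        (if a (k + 1 + 1) < t then len (k + 1 + 1) else 0) = l := by
      intro k hk
      rw [if_pos ((key _).mpr (by rw [hN]; simpa using hk)), hlen _ (by omega)]
    have h1 : a (0 + 1) < t := (key 0).mpr hpos
    rw [Finset.sum_congr rfl h, if_pos h1, hlen0]
    simp [hlen1]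
    ring
  · intro n hn
    obtain _ | k := n
    · simp at hn
    · rw [if_neg]
      rw [key]
      simpa using hn

/-- The output bound derived from the faulty service curve `c·t` is
incorrect. With `c > 0`, `τ > 0`, `σ > l > 0`, `l/τ < c` and `τ < σ/c`, packet
`n ≥ 1` arrives at `a(n) = (n−1)·τ` with `l(1) = σ`, `l(n) = l` for `n ≥ 2`,
served FIFO at rate `c`. The input has the arrival curve `(l/τ)·t + σ`, but
there exist `s, t ≥ 0` with `A*(s + t) − A*(s) > (l/τ)·t + σ`, so `(l/τ)·t + σ`
is not an arrival curve of the output. -/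
theorem faulty_output_bound_CBR
    (c τ σ l : ℝ) (hc : 0 < c) (hτ : 0 < τ) (hl : 0 < l) (hσ : l < σ)
    (hstab : l / τ < c) (hτσ : τ < σ / c)
    (a len : ℕ → ℝ)
    (ha : ∀ n, a n = ((n : ℝ) - 1) * τ)
    (hlen0 : len 0 = 0) (hlen1 : len 1 = σ)
    (hlen : ∀ n, 2 ≤ n → len n = l)
    (A Astar : ℝ → ℝ)
    (hA : ∀ t, A t = ∑' n : ℕ, if a n < t then len n else 0)
    (hAstar : ∀ t, Astar t = ∑' n : ℕ, if dep c a len n < t then len n else 0) :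
    (∀ s t, 0 ≤ s → s ≤ t → A t - A s ≤ (l / τ) * (t - s) + σ) ∧
    ∃ s t, 0 ≤ s ∧ 0 ≤ t ∧ (l / τ) * t + σ < Astar (s + t) - Astar s := by
  have hσ0 : 0 < σ := hl.trans hσ
  have hlen_nonneg : ∀ n, 0 ≤ len n := by
    intro n
    obtain _ | _ | n := n
    · exact hlen0.ge
    · rw [hlen1]; exact hσ0.le
    · rw [hlen _ (by omega)]; exact hl.le
  refine ⟨?_, ?_⟩
  · intro s t hs hst
    have hlτ : 0 ≤ l / τ := (div_pos hl hτ).le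
    obtain rfl | hst' := hst.eq_or_lt
    · simpa using hσ0.le
    have ht : 0 < t := hs.trans_lt hst'
    have hct := mul_lt_mul_of_pos_left (Nat.ceil_lt_add_one (div_pos ht hτ).le) hl
    have e1 : l * (t / τ) = l / τ * t := by ring
    rw [hA t, tsum_periodic_arrivals hτ ha hlen0 hlen1 hlen ht]
    obtain rfl | hs' := hs.eq_or_lt
    · have h0 : 0 ≤ A 0 := by
        rw [hA]
        refine tsum_nonneg fun n => ?_
        split_ifs
        exacts [hlen_nonneg n, le_rfl]
      linarith
    · have hcs := mul_le_mul_of_nonneg_left (Nat.le_ceil (s / τ)) hl.le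
      have e2 : l * (s / τ) = l / τ * s := by ring
      rw [hA s, tsum_periodic_arrivals hτ ha hlen0 hlen1 hlen hs']
      linarith
  · have hlc : l / c < τ := by
      rw [div_lt_iff₀ hτ] at hstab
      rw [div_lt_iff₀ hc]
      linarith
    have hσc : 0 < σ / c := hτ.trans hτσ
    have hlc0 : 0 < l / c := div_pos hl hc
    obtain ⟨t, hlt, htτ⟩ := exists_between hlc
    have hd1 : dep c a len 1 = σ / c := by simp [dep, ha, hlen1]
    have hd2 : dep c a len 2 = σ / c + l / c := by
      have h : dep c a len 2 = max (a 2) (dep c a len 1) + len 2 / c := rfl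
      rw [h, hd1, hlen 2 le_rfl, ha, max_eq_right]
      norm_num
      exact hτσ.le
    refine ⟨σ / c, t, hσc.le, (hlc0.trans hlt).le, ?_⟩
    have hs : Astar (σ / c) = 0 := by
      rw [hAstar]
      refine (tsum_congr fun n => ?_).trans tsum_zero
      obtain _ | n := n
      · simp [hlen0]
      · rw [if_neg]
        rw [not_lt, ← hd1]
        exact dep_monotone hc hlen_nonneg (by omega)
    have hsum : Summable fun n : ℕ =>
        if dep c a len n < σ / c + t then len n else 0 := by
      refine summable_of_ne_finset_zero (s := Finset.range (⌈(σ / c + t) / τ⌉₊ + 1)) ?_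
      intro n hn
      obtain _ | k := n
      · simp at hn
      · have hk : ⌈(σ / c + t) / τ⌉₊ ≤ k := by simpa using hn
        have h := le_dep_succ (a := a) hc hlen_nonneg k
        rw [Nat.ceil_le, div_le_iff₀ hτ] at hk
        rw [ha] at h
        push_cast at h
        rw [if_neg]
        rw [not_lt]
        linarith
    have hge : σ + l ≤ Astar (σ / c + t) := by
      have h := hsum.sum_le_tsum {1, 2} fun n _ => by
        split_ifs
        exacts [hlen_nonneg n, le_rfl]
      rw [Finset.sum_pair (by norm_num), if_pos (by rw [hd1]; linarith),
        if_pos (by rw [hd2]; linarith), hlen1, hlen 2 le_rfl] at h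
      rw [hAstar]
      exact h
    have hlt' : l / τ * t < l := by
      rw [div_mul_eq_mul_div, div_lt_iff₀ hτ]
      exact mul_lt_mul_of_pos_left htτ hl
    linarith
end

section
/- The backlog bound σ derived from the faulty service curve c·t is incorrect: the backlog of a packetized constant bit rate server fed with a (l/τ)·t + σ constrained flow can exceed σ. Concretely: let c > 0, τ > 0 and σ > l > 0 satisfy l/τ < c and τ < σ/c. Packet n arrives at a(n) = (n − 1)·τ with length l(1) = σ and l(n) = l for n ≥ 2, and is served FIFO at constant rate c, i.e., with d(0) = 0 the departure times satisfy d(n) = max(a(n), d(n − 1)) + l(n)/c; the cumulative input is A(t) = Σ_{n : a(n) < t} l(n), the cumulative output is A*(t) = Σ_{n : d(n) < t} l(n), and the backlog is B(t) = A(t) − A*(t). Then there exists t ≥ 0 with B(t) = σ + l > σ; in particular, for every t with τ < t ≤ min(2τ, σ/c), B(t) = σ + l. -/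
/-- With nonnegative lengths, no packet departs before the time needed to
transmit the first one. -/
theorem div_le_dep_succ {c : ℝ} {a len : ℕ → ℝ} (hc : 0 ≤ c)
    (hlen : ∀ n, 0 ≤ len n) (n : ℕ) : len 1 / c ≤ dep c a len (n + 1) := by
  induction n with
  | zero => simp [dep]
  | succ n ih =>
    rw [dep]
    exact (ih.trans (le_max_right _ _)).trans
      (le_add_of_nonneg_right (div_nonneg (hlen _) hc))

/-- The backlog bound `σ` derived from the faulty service curve `c·t`
is incorrect. With `c > 0`, `τ > 0`, `σ > l > 0`, `l/τ < c` and `τ < σ/c`, packet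
`n ≥ 1` arrives at `a(n) = (n−1)·τ` with `l(1) = σ`, `l(n) = l` for `n ≥ 2`,
served FIFO at rate `c`. Then there exists `t ≥ 0` with backlog
`B(t) = σ + l > σ`; in particular `B(t) = σ + l` for every `τ < t ≤ min(2τ, σ/c)`. -/
theorem faulty_backlog_bound_CBR
    (c τ σ l : ℝ) (hc : 0 < c) (hτ : 0 < τ) (hl : 0 < l) (hσ : l < σ)
    (hstab : l / τ < c) (hτσ : τ < σ / c)
    (a len : ℕ → ℝ)
    (ha : ∀ n, a n = ((n : ℝ) - 1) * τ)
    (hlen0 : len 0 = 0) (hlen1 : len 1 = σ)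
    (hlen : ∀ n, 2 ≤ n → len n = l)
    (A Astar B : ℝ → ℝ)
    (hA : ∀ t, A t = ∑' n : ℕ, if a n < t then len n else 0)
    (hAstar : ∀ t, Astar t = ∑' n : ℕ, if dep c a len n < t then len n else 0)
    (hB : ∀ t, B t = A t - Astar t) :
    (∃ t, 0 ≤ t ∧ B t = σ + l ∧ σ < σ + l) ∧
    (∀ t, τ < t → t ≤ min (2 * τ) (σ / c) → B t = σ + l) := by
  have backlog_eq : ∀ t, τ < t → t ≤ min (2 * τ) (σ / c) → B t = σ + l := by
    intro t ht ht'
    obtain ⟨ht2, htc⟩ := le_min_iff.mp ht'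
    have hlen_nonneg : ∀ n, 0 ≤ len n
      | 0 => hlen0.ge
      | 1 => by linarith
      | n + 2 => by rw [hlen _ (by omega)]; exact hl.le
    have output : Astar t = 0 := by
      rw [hAstar]
      refine (tsum_congr fun n => ?_).trans tsum_zero
      cases n with
      | zero => simp [hlen0]
      | succ n =>
        have := div_le_dep_succ (a := a) hc.le hlen_nonneg n
        rw [hlen1] at this
        exact if_neg (not_lt.mpr (htc.trans this))
    have input : A t = σ + l := by
      rw [hA, tsum_eq_sum (s := Finset.range 3)]
      · have h1 : a 1 < t := by rw [ha]; push_cast; linarith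
        have h2 : a 2 < t := by rw [ha]; push_cast; linarith
        simp [Finset.sum_range_succ, hlen0, hlen1, hlen 2 le_rfl, h1, h2]
      · intro n hn
        have hn3 : (3 : ℝ) ≤ n := by
          exact_mod_cast not_lt.mp (fun h => hn (Finset.mem_range.mpr h))
        refine if_neg (not_lt.mpr ?_)
        rw [ha]
        nlinarith
    rw [hB, input, output, sub_zero]
  have hlt : τ < min (2 * τ) (σ / c) := lt_min (by linarith) hτσ
  exact ⟨⟨_, (hτ.trans hlt).le, backlog_eq _ hlt le_rfl, by linarith⟩, backlog_eq⟩
end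

section
/- Backlog bound for a packetized constant bit rate server with token-bucket constrained input: let c > 0, let packets n = 1, 2, ... arrive at times 0 ≤ a(1) ≤ a(2) ≤ ... with lengths 0 < l(n) ≤ l^M, served with d(0) = 0 and d(n) = max(a(n), d(n − 1)) + l(n)/c; let A(t) = Σ_{n : a(n) < t} l(n), A*(t) = Σ_{n : d(n) < t} l(n), and B(t) = A(t) − A*(t). If A(t) − A(s) ≤ ρ·(t − s) + σ for all 0 ≤ s ≤ t with 0 ≤ ρ ≤ c and σ ≥ 0, then for all t ≥ 0, B(t) ≤ σ + (ρ/c)·l^M. -/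
/-- A packet of positive length departs strictly after it arrives. -/
theorem lt_dep {c : ℝ} (hc : 0 < c) {a len : ℕ → ℝ} {n : ℕ} (hn : 1 ≤ n)
    (hlen : 0 < len n) : a n < dep c a len n := by
  obtain ⟨k, rfl⟩ := Nat.exists_eq_add_of_le' hn
  have := div_pos hlen hc
  have := le_max_left (a (k + 1)) (dep c a len k)
  simp only [dep]
  linarith

/-- The departure time of packet `n + 1` is the start `a m` of its busy period plus the
transmission time of the packets `m, …, n + 1`. -/
theorem exists_dep_eq {c : ℝ} {a len : ℕ → ℝ} (ha1 : 0 ≤ a 1) (n : ℕ) :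
    ∃ m, 1 ≤ m ∧ m ≤ n + 1 ∧
      dep c a len (n + 1) = a m + (∑ i ∈ Finset.Ico m (n + 2), len i) / c := by
  induction n with
  | zero => exact ⟨1, le_rfl, le_rfl, by simp [dep, ha1]⟩
  | succ k ih =>
    rcases le_total (dep c a len (k + 1)) (a (k + 2)) with h | h
    · exact ⟨k + 2, by omega, le_rfl, by rw [dep, max_eq_left h]; simp⟩
    · obtain ⟨m, hm1, hmk, hm⟩ := ih
      refine ⟨m, hm1, by omega, ?_⟩
      rw [dep, max_eq_right h, hm, Finset.sum_Ico_succ_top (by omega : m ≤ k + 2), add_div]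
      ring

/-- Backlog bound for a packetized constant bit rate server with
token-bucket constrained input: if the input satisfies
`A(t) − A(s) ≤ ρ·(t − s) + σ` for all `0 ≤ s ≤ t` with `0 ≤ ρ ≤ c` and `σ ≥ 0`,
then for all `t ≥ 0`, the backlog satisfies `B(t) ≤ σ + (ρ/c)·l^M`. -/
theorem backlog_bound_CBR
    (c lM ρ σ : ℝ) (hc : 0 < c)
    (a len : ℕ → ℝ)
    (ha1 : 0 ≤ a 1) (hamono : ∀ n, 1 ≤ n → a n ≤ a (n + 1))
    (hlen0 : len 0 = 0)
    (hlen : ∀ n, 1 ≤ n → 0 < len n ∧ len n ≤ lM)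
    (A Astar B : ℝ → ℝ)
    (hA : ∀ t, A t = ∑' n : ℕ, if a n < t then len n else 0)
    (hAstar : ∀ t, Astar t = ∑' n : ℕ, if dep c a len n < t then len n else 0)
    (hB : ∀ t, B t = A t - Astar t)
    (hρ0 : 0 ≤ ρ) (hρc : ρ ≤ c) (hσ : 0 ≤ σ)
    (harr : ∀ s t, 0 ≤ s → s ≤ t → A t - A s ≤ ρ * (t - s) + σ) :
    ∀ t, 0 ≤ t → B t ≤ σ + (ρ / c) * lM := by
  intro t _
  have hmono : ∀ m n, 1 ≤ m → m ≤ n → a m ≤ a n := fun m n hm hmn =>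
    Nat.le_induction le_rfl (fun k hk ih => ih.trans (hamono k (hm.trans hk))) n hmn
  have hnonneg : ∀ n, 0 ≤ len n := fun n => by
    rcases Nat.eq_zero_or_pos n with rfl | hn
    · exact hlen0.ge
    · exact (hlen n hn).1.le
  have hlM : 0 ≤ lM := (hlen 1 le_rfl).1.le.trans (hlen 1 le_rfl).2
  have hbound : 0 ≤ σ + ρ / c * lM := by positivity
  have hserved : ∀ n, 0 ≤ if dep c a len n < t then len n else 0 := fun n => by
    split_ifs
    exacts [hnonneg n, le_rfl]
  have hle : ∀ n, (if dep c a len n < t then len n else 0) ≤ if a n < t then len n else 0 := by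
    intro n
    rcases Nat.eq_zero_or_pos n with rfl | hn
    · simp [hlen0]
    · have := lt_dep hc (a := a) hn (hlen n hn).1
      have := hnonneg n
      split_ifs <;> linarith
  rw [hB]
  by_cases hsum : Summable fun n => if a n < t then len n else 0
  swap
  · have : 0 ≤ Astar t := by rw [hAstar]; exact tsum_nonneg hserved
    rw [hA, tsum_eq_zero_of_not_summable hsum]
    linarith
  have hsum' := Summable.of_nonneg_of_le hserved hle hsum
  by_cases hex : ∃ n, 1 ≤ n ∧ a n < t ∧ t ≤ dep c a len n
  swap
  · have heq : A t = Astar t := by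
      rw [hA, hAstar]
      refine tsum_congr fun n => le_antisymm ?_ (hle n)
      rcases Nat.eq_zero_or_pos n with rfl | hn
      · simp [hlen0]
      · push Not at hex
        have := hex n hn
        split_ifs with h1 h2
        · exact le_rfl
        · exact absurd (this h1) h2
        · exact hnonneg n
        · exact le_rfl
    linarith
  classical
  obtain ⟨N, ⟨hN1, haN, hdN⟩, hmin⟩ : ∃ N, (1 ≤ N ∧ a N < t ∧ t ≤ dep c a len N) ∧
      ∀ i < N, ¬(1 ≤ i ∧ a i < t ∧ t ≤ dep c a len i) :=
    ⟨Nat.find hex, Nat.find_spec hex, fun i hi => Nat.find_min hex hi⟩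
  obtain ⟨k, rfl⟩ := Nat.exists_eq_add_of_le' hN1
  obtain ⟨m, hm1, hmk, hm⟩ := exists_dep_eq (c := c) (len := len) ha1 k
  have hstart : A (a m) ≤ ∑ i ∈ Finset.range m, len i := by
    rw [hA, tsum_eq_sum (s := Finset.range m)]
    · refine Finset.sum_le_sum fun i _ => ?_
      split_ifs
      exacts [le_rfl, hnonneg i]
    · intro i hi
      rw [Finset.mem_range, not_lt] at hi
      exact if_neg (hmono m i hm1 hi).not_gt
  have hout : ∑ i ∈ Finset.range (k + 1), len i ≤ Astar t := by
    rw [hAstar]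
    refine le_trans (Finset.sum_le_sum fun i hi => ?_)
      (hsum'.sum_le_tsum (Finset.range (k + 1)) fun i _ => hserved i)
    rcases Nat.eq_zero_or_pos i with rfl | hi1
    · simp [hlen0]
    · rw [Finset.mem_range] at hi
      have hlt : dep c a len i < t := by
        by_contra! h
        exact hmin i hi ⟨hi1, (hmono i _ hi1 hi.le).trans_lt haN, h⟩
      rw [if_pos hlt]
  rw [← Finset.sum_range_add_sum_Ico len hmk] at hout
  rw [Finset.sum_Ico_succ_top hmk] at hm
  set L := ∑ i ∈ Finset.Ico m (k + 1), len i
  have hL : 0 ≤ L := Finset.sum_nonneg fun i _ => hnonneg i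
  have hamk := hmono m _ hm1 hmk
  have hin := harr (a m) t (ha1.trans (hmono 1 m le_rfl hm1)) (hamk.trans haN.le)
  have hdur : ρ * (t - a m) ≤ ρ / c * (L + lM) := by
    rw [div_mul_eq_mul_div, mul_div_assoc]
    refine mul_le_mul_of_nonneg_left ?_ hρ0
    have : (L + len (k + 1)) / c ≤ (L + lM) / c :=
      div_le_div_of_nonneg_right (by linarith [(hlen (k + 1) hN1).2]) hc.le
    linarith
  have hrate : ρ / c * L ≤ L := mul_le_of_le_one_left hL ((div_le_one hc).2 hρc)
  rw [mul_add] at hdur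
  linarith
end

section
/- Concatenation service curve for two packetized constant bit rate servers in tandem: let c1, c2 > 0, let packets n = 1, 2, ... arrive at times 0 ≤ a(1) ≤ a(2) ≤ ... with lengths 0 < l(n) ≤ l^M, and traverse two FIFO servers in sequence with departure recursions d1(0) = d2(0) = 0, d1(n) = max(a(n), d1(n − 1)) + l(n)/c1 and d2(n) = max(d1(n), d2(n − 1)) + l(n)/c2; let A(t) = Σ_{n : a(n) < t} l(n) be the cumulative input to the first server and A*₂(t) = Σ_{n : d2(n) < t} l(n) the cumulative output of the second. Then for all t ≥ 0, A*₂(t) ≥ inf_{0 ≤ s ≤ t} { A(s) + min(c1, c2)·max(t − s − l^M/c1 − l^M/c2, 0) }; i.e., the tandem offers the service curve min(c1, c2)·(t − l^M/c1 − l^M/c2)^+. -/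
lemma dep_mono {c : ℝ} (hc : 0 < c) {a len : ℕ → ℝ} (hlen : ∀ n, 0 ≤ len n) :
    Monotone (dep c a len) := by
  refine monotone_nat_of_le_succ fun n => ?_
  have h1 : 0 ≤ len (n + 1) / c := div_nonneg (hlen _) hc.le
  have h2 := le_max_right (a (n + 1)) (dep c a len n)
  simp only [dep]
  linarith

lemma le_dep {c : ℝ} (hc : 0 < c) {a len : ℕ → ℝ} (hlen : ∀ n, 0 ≤ len n) {n : ℕ}
    (hn : 1 ≤ n) : a n ≤ dep c a len n := by
  obtain ⟨m, rfl⟩ := Nat.exists_eq_add_of_le' hn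
  have h1 : 0 ≤ len (m + 1) / c := div_nonneg (hlen _) hc.le
  have h2 := le_max_left (a (m + 1)) (dep c a len m)
  simp only [dep]
  linarith

/-- A departure time is bounded by the availability time of the packet starting the busy period,
plus the service time of the packets since then, where all packets but the last may be charged at
a smaller rate `r`. -/
lemma exists_dep_le {c r : ℝ} (hr : 0 < r) (hrc : r ≤ c) {a len : ℕ → ℝ} (ha : 0 ≤ a 1)
    (hlen : ∀ n, 0 ≤ len n) {n : ℕ} (hn : 1 ≤ n) :
    ∃ p, 1 ≤ p ∧ p ≤ n ∧ dep c a len n ≤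
      a p + (∑ k ∈ Finset.range n, len k - ∑ k ∈ Finset.range p, len k) / r + len n / c := by
  induction n, hn using Nat.le_induction with
  | base => exact ⟨1, le_rfl, le_rfl, by simp [dep, ha]⟩
  | succ n hn ih =>
    rcases le_total (dep c a len n) (a (n + 1)) with h | h
    · exact ⟨n + 1, by omega, le_rfl, by simp [dep, h]⟩
    · obtain ⟨p, hp1, hpn, hp⟩ := ih
      refine ⟨p, hp1, by omega, ?_⟩
      have h1 : len n / c ≤ len n / r := div_le_div_of_nonneg_left (hlen n) hr hrc
      simp only [dep, max_eq_right h, Finset.sum_range_succ]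
      have h2 : (∑ k ∈ Finset.range n, len k + len n - ∑ k ∈ Finset.range p, len k) / r =
          (∑ k ∈ Finset.range n, len k - ∑ k ∈ Finset.range p, len k) / r + len n / r := by
        ring
      linarith

/-- Concatenation service curve for two packetized constant bit
rate servers in tandem (rates `c1`, `c2`): with `d1(n) = max(a(n), d1(n−1)) +
l(n)/c1` and `d2(n) = max(d1(n), d2(n−1)) + l(n)/c2`, for all `t ≥ 0` the output
of the second server satisfies
`A*₂(t) ≥ inf_{0 ≤ s ≤ t} ( A(s) + min(c1, c2)·max(t − s − l^M/c1 − l^M/c2, 0) )`,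
i.e. the tandem offers the service curve `min(c1,c2)·(t − l^M/c1 − l^M/c2)⁺`. -/
theorem concatenation_service_curve_CBR
    (c1 c2 lM : ℝ) (hc1 : 0 < c1) (hc2 : 0 < c2)
    (a len : ℕ → ℝ)
    (ha1 : 0 ≤ a 1) (hamono : ∀ n, 1 ≤ n → a n ≤ a (n + 1))
    (hlen0 : len 0 = 0)
    (hlen : ∀ n, 1 ≤ n → 0 < len n ∧ len n ≤ lM)
    (A Astar2 : ℝ → ℝ)
    (hA : ∀ t, A t = ∑' n : ℕ, if a n < t then len n else 0)
    (hAstar2 : ∀ t, Astar2 t =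
      ∑' n : ℕ, if dep c2 (dep c1 a len) len n < t then len n else 0) :
    ∀ t, 0 ≤ t →
      sInf ((fun s => A s + min c1 c2 * max (t - s - lM / c1 - lM / c2) 0) ''
        Set.Icc 0 t) ≤ Astar2 t := by
  intro t ht
  have hlen' : ∀ n, 0 ≤ len n := by
    intro n
    rcases Nat.eq_zero_or_pos n with rfl | hn
    · exact hlen0.ge
    · exact (hlen n hn).1.le
  have hlM : 0 ≤ lM := (hlen' 1).trans (hlen 1 le_rfl).2
  have hL1 : 0 ≤ lM / c1 := div_nonneg hlM hc1.le
  have hL2 : 0 ≤ lM / c2 := div_nonneg hlM hc2.le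
  have hr : 0 < min c1 c2 := lt_min hc1 hc2
  have hA0 : ∀ s, 0 ≤ A s := by
    intro s
    rw [hA]
    refine tsum_nonneg fun n => ?_
    split_ifs
    exacts [hlen' n, le_rfl]
  suffices h : ∃ s ∈ Set.Icc 0 t,
      A s + min c1 c2 * max (t - s - lM / c1 - lM / c2) 0 ≤ Astar2 t by
    obtain ⟨s, hs, hle⟩ := h
    refine (csInf_le ⟨0, ?_⟩ (Set.mem_image_of_mem _ hs)).trans hle
    rintro _ ⟨u, -, rfl⟩
    exact add_nonneg (hA0 u) (mul_nonneg hr.le (le_max_right _ _))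
  have hd1 : 0 ≤ dep c1 a len 1 := ha1.trans (le_dep hc1 hlen' le_rfl)
  by_cases hex : ∃ n, 1 ≤ n ∧ t ≤ dep c2 (dep c1 a len) len n
  · classical
    obtain ⟨hN1, hNt⟩ := Nat.find_spec hex
    have hmin := fun m (hm : m < Nat.find hex) => Nat.find_min hex hm
    generalize Nat.find hex = N at hN1 hNt hmin
    have hout : Astar2 t = ∑ k ∈ Finset.range N, len k := by
      rw [hAstar2, tsum_eq_sum (s := Finset.range N)]
      · refine Finset.sum_congr rfl fun k hk => ?_
        rcases Nat.eq_zero_or_pos k with rfl | hk1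
        · simp [hlen0]
        · exact if_pos (not_le.1 fun h => hmin k (Finset.mem_range.1 hk) ⟨hk1, h⟩)
      · intro k hk
        exact if_neg (not_lt.2 (hNt.trans (dep_mono hc2 hlen'
          (not_lt.1 fun h => hk (Finset.mem_range.2 h)))))
    obtain ⟨q, hq1, hqN, hq⟩ := exists_dep_le hr (min_le_right c1 c2) hd1 hlen' hN1
    obtain ⟨p, hp1, hpq, hp⟩ := exists_dep_le hr (min_le_left c1 c2) ha1 hlen' hq1
    have hamono' : ∀ m, 1 ≤ m → ∀ n, m ≤ n → a m ≤ a n := by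
      intro m hm n hmn
      induction n, hmn using Nat.le_induction with
      | base => exact le_rfl
      | succ n hn ih => exact ih.trans (hamono n (hm.trans hn))
    have hP : ∑ k ∈ Finset.range p, len k ≤ ∑ k ∈ Finset.range N, len k :=
      Finset.sum_le_sum_of_subset_of_nonneg (Finset.range_subset_range.2 (hpq.trans hqN))
        fun k _ _ => hlen' k
    have hin : A (min (a p) t) ≤ ∑ k ∈ Finset.range p, len k := by
      rw [hA, tsum_eq_sum (s := Finset.range p)]
      · refine Finset.sum_le_sum fun k _ => ?_
        split_ifs
        exacts [le_rfl, hlen' k]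
      · intro k hk
        exact if_neg (not_lt.2 ((min_le_left _ _).trans
          (hamono' p hp1 k (not_lt.1 fun h => hk (Finset.mem_range.2 h)))))
    refine ⟨min (a p) t, ⟨le_min (ha1.trans (hamono' 1 le_rfl p hp1)) ht, min_le_right _ _⟩, ?_⟩
    have hq' : len q / c1 ≤ lM / c1 := div_le_div_of_nonneg_right (hlen q hq1).2 hc1.le
    have hN' : len N / c2 ≤ lM / c2 := div_le_div_of_nonneg_right (hlen N hN1).2 hc2.le
    have hservice : max (t - min (a p) t - lM / c1 - lM / c2) 0 ≤
        (∑ k ∈ Finset.range N, len k - ∑ k ∈ Finset.range p, len k) / min c1 c2 := by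
      have hnn := div_nonneg (sub_nonneg.2 hP) hr.le
      refine max_le ?_ hnn
      rcases le_total (a p) t with h | h
      · rw [min_eq_left h]
        rw [sub_div] at hp hq ⊢
        linarith
      · rw [min_eq_right h]
        linarith
    rw [le_div_iff₀ hr, mul_comm] at hservice
    linarith
  · push Not at hex
    refine ⟨t, ⟨ht, le_rfl⟩, ?_⟩
    have hzero : max (t - t - lM / c1 - lM / c2) 0 = 0 := max_eq_right (by linarith)
    rw [hzero, mul_zero, add_zero, hA, hAstar2]
    refine (tsum_congr fun n => ?_).le
    rcases Nat.eq_zero_or_pos n with rfl | hn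
    · simp [hlen0]
    · have hlt := hex n hn
      rw [if_pos hlt,
        if_pos (((le_dep hc1 hlen' hn).trans (le_dep hc2 hlen' hn)).trans_lt hlt)]
end

section
/- Virtual delay bound for the highest priority queue of a packetized non-preemptive strict priority server with token-bucket constrained input: let c > 0, L ≥ 0, let high-priority packets n = 1, 2, ... arrive at times 0 ≤ a(1) ≤ a(2) ≤ ... with lengths 0 < l(n) ≤ l^M, with departures d(0) = 0 and d(n) = max(a(n) + w(n), d(n − 1)) + l(n)/c, where w(n) ∈ [0, L/c] and w(n) = 0 whenever a(n) < d(n − 1); let A(t) = Σ_{n : a(n) < t} l(n) and A*(t) = Σ_{n : d(n) < t} l(n), and define the virtual delay D(t) = inf{ τ ≥ 0 : A(t) ≤ A*(t + τ) }. If A(t) − A(s) ≤ ρ·(t − s) + σ for all 0 ≤ s ≤ t with 0 ≤ ρ ≤ c and σ ≥ 0, then for all t ≥ 0, D(t) ≤ (σ + l^M + L)/c. -/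
/-- Every packet lies in a busy period, opened by some packet `m` which is the only one of the
period to be blocked by lower-priority traffic. -/
theorem exists_dep_le_busy_period {c L : ℝ} {a w len : ℕ → ℝ} (ha1 : 0 ≤ a 1)
    (hw : ∀ n, 1 ≤ n → 0 ≤ w n ∧ w n ≤ L / c)
    (hw0 : ∀ n, a (n + 1) < dep c (fun k => a k + w k) len n → w (n + 1) = 0) (n : ℕ) :
    ∃ m, 1 ≤ m ∧ m ≤ n + 1 ∧ dep c (fun k => a k + w k) len (n + 1) ≤
      a m + L / c + (∑ i ∈ Finset.Icc m (n + 1), len i) / c := by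
  have fresh (n : ℕ) (h : dep c (fun k => a k + w k) len n ≤ a (n + 1)) :
      ∃ m, 1 ≤ m ∧ m ≤ n + 1 ∧ dep c (fun k => a k + w k) len (n + 1) ≤
        a m + L / c + (∑ i ∈ Finset.Icc m (n + 1), len i) / c := by
    refine ⟨n + 1, by omega, le_rfl, ?_⟩
    obtain ⟨h0, h1⟩ := hw (n + 1) (by omega)
    rw [dep, max_eq_left (by linarith), Finset.Icc_self, Finset.sum_singleton]
    linarith
  induction n with
  | zero => exact fresh 0 (by simpa [dep] using ha1)
  | succ n ih =>
    rcases le_or_gt (dep c (fun k => a k + w k) len (n + 1)) (a (n + 1 + 1)) with h | h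
    · exact fresh _ h
    · obtain ⟨m, hm1, hmn, hd⟩ := ih
      refine ⟨m, hm1, by omega, ?_⟩
      rw [dep, hw0 _ h, add_zero, max_eq_right h.le,
        Finset.sum_Icc_succ_top (by omega : m ≤ n + 1 + 1), add_div]
      linarith

theorem sum_range_succ_len_le_dep {c : ℝ} (hc : 0 < c) {a len : ℕ → ℝ} (hlen0 : len 0 = 0)
    (n : ℕ) : ∑ i ∈ Finset.range (n + 1), len i ≤ c * dep c a len n := by
  induction n with
  | zero => simp [dep, hlen0]
  | succ n ih =>
    rw [Finset.sum_range_succ, dep, mul_add, mul_div_cancel₀ _ hc.ne']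
    gcongr
    exact ih.trans (by gcongr; exact le_max_right _ _)

/-- The work departing before any given time is finite. -/
theorem summable_len_of_dep_lt {c : ℝ} (hc : 0 < c) {a len : ℕ → ℝ} (hlen0 : len 0 = 0)
    (hlen : ∀ n, 0 ≤ len n) (u : ℝ) :
    Summable fun n => if dep c a len n < u then len n else 0 := by
  refine summable_of_sum_range_le (c := c * max u 0)
    (fun n => by split_ifs <;> simp [hlen]) fun n => ?_
  induction n with
  | zero => simpa using mul_nonneg hc.le (le_max_right u 0)
  | succ n ih =>
    by_cases h : dep c a len n < u
    · calc ∑ i ∈ Finset.range (n + 1), (if dep c a len i < u then len i else 0)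
          ≤ ∑ i ∈ Finset.range (n + 1), len i :=
            Finset.sum_le_sum fun i _ => by split_ifs <;> simp [hlen]
        _ ≤ c * dep c a len n := sum_range_succ_len_le_dep hc hlen0 n
        _ ≤ c * max u 0 := by gcongr; exact h.le.trans (le_max_left _ _)
    · rwa [Finset.sum_range_succ, if_neg h, add_zero]

theorem le_of_forall_one_le_le_succ {a : ℕ → ℝ} (hamono : ∀ n, 1 ≤ n → a n ≤ a (n + 1)) {i j : ℕ}
    (hi : 1 ≤ i) (hij : i ≤ j) : a i ≤ a j := by
  induction j, hij using Nat.le_induction with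
  | base => exact le_rfl
  | succ j hj ih => exact ih.trans (hamono j (hi.trans hj))

theorem sum_Icc_add_tsum_arrivals_le {a len : ℕ → ℝ} (hlen : ∀ n, 0 ≤ len n)
    (hamono : ∀ n, 1 ≤ n → a n ≤ a (n + 1)) {m n : ℕ} (hm : 1 ≤ m) (hmn : m ≤ n) {t : ℝ}
    (hn : a n < t) (hsum : Summable fun k => if a k < t then len k else 0) :
    ∑ i ∈ Finset.Icc m n, len i + ∑' k, (if a k < a m then len k else 0) ≤
      ∑' k, if a k < t then len k else 0 := by
  have mono {i j : ℕ} (hi : 1 ≤ i) (hij : i ≤ j) : a i ≤ a j :=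
    le_of_forall_one_le_le_succ hamono hi hij
  have hmt : a m < t := (mono hm hmn).trans_lt hn
  have hle (k : ℕ) : (if a k < a m then len k else 0) ≤ if a k < t then len k else 0 := by
    by_cases h : a k < a m
    · simp [h, h.trans hmt]
    · rw [if_neg h]
      split_ifs <;> simp [hlen]
  have hsum' : Summable fun k => if a k < a m then len k else 0 :=
    hsum.of_nonneg_of_le (fun k => by split_ifs <;> simp [hlen]) hle
  have key := (hsum.sub hsum').sum_le_tsum (Finset.Icc m n) fun k _ => sub_nonneg.2 (hle k)
  rw [hsum.tsum_sub hsum', Finset.sum_congr rfl (g := len)] at key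
  · linarith
  · intro k hk
    obtain ⟨hmk, hkn⟩ := Finset.mem_Icc.1 hk
    rw [if_pos ((mono (hm.trans hmk) hkn).trans_lt hn), if_neg (mono hm hmk).not_gt, sub_zero]

/-- Virtual delay bound for the highest priority queue of a
packetized non-preemptive strict priority server with token-bucket constrained
input: if `A(t) − A(s) ≤ ρ·(t − s) + σ` for all `0 ≤ s ≤ t` with `0 ≤ ρ ≤ c`
and `σ ≥ 0`, then the virtual delay `D(t) = inf{τ ≥ 0 : A(t) ≤ A*(t + τ)}`
satisfies `D(t) ≤ (σ + l^M + L)/c` for all `t ≥ 0`. -/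
theorem virtual_delay_bound_SP
    (c L lM ρ σ : ℝ) (hc : 0 < c) (hL : 0 ≤ L)
    (a w len : ℕ → ℝ)
    (ha1 : 0 ≤ a 1) (hamono : ∀ n, 1 ≤ n → a n ≤ a (n + 1))
    (hlen0 : len 0 = 0)
    (hlen : ∀ n, 1 ≤ n → 0 < len n ∧ len n ≤ lM)
    (hw : ∀ n, 1 ≤ n → 0 ≤ w n ∧ w n ≤ L / c)
    (hw0 : ∀ n, a (n + 1) < dep c (fun k => a k + w k) len n → w (n + 1) = 0)
    (A Astar D : ℝ → ℝ)
    (hA : ∀ t, A t = ∑' n : ℕ, if a n < t then len n else 0)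
    (hAstar : ∀ t, Astar t =
      ∑' n : ℕ, if dep c (fun k => a k + w k) len n < t then len n else 0)
    (hD : ∀ t, D t = sInf {τ : ℝ | 0 ≤ τ ∧ A t ≤ Astar (t + τ)})
    (hρ0 : 0 ≤ ρ) (hρc : ρ ≤ c) (hσ : 0 ≤ σ)
    (harr : ∀ s t, 0 ≤ s → s ≤ t → A t - A s ≤ ρ * (t - s) + σ) :
    ∀ t, 0 ≤ t → D t ≤ (σ + lM + L) / c := by
  intro t ht
  have hl (n : ℕ) : 0 ≤ len n := by
    rcases n.eq_zero_or_pos with rfl | h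
    exacts [hlen0.ge, (hlen n h).1.le]
  have hlM : 0 ≤ lM := (hlen 1 le_rfl).1.le.trans (hlen 1 le_rfl).2
  rw [hD]
  refine le_of_forall_pos_le_add fun ε hε =>
    csInf_le ⟨0, fun τ hτ => hτ.1⟩ ⟨by positivity, ?_⟩
  rw [hAstar]
  have hnonneg (n : ℕ) : 0 ≤ if dep c (fun k => a k + w k) len n <
      t + ((σ + lM + L) / c + ε) then len n else 0 := by
    split_ifs <;> simp [hl]
  by_cases hsum : Summable fun n => if a n < t then len n else 0
  swap
  · rw [hA, tsum_eq_zero_of_not_summable hsum]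
    exact tsum_nonneg hnonneg
  rw [hA]
  refine hsum.tsum_le_tsum (fun n => ?_) (summable_len_of_dep_lt hc hlen0 hl _)
  by_cases hn : a n < t
  swap
  · rw [if_neg hn]
    exact hnonneg n
  rcases n with _ | n
  · simp [hlen0]
  obtain ⟨m, hm1, hmn, hd⟩ := exists_dep_le_busy_period ha1 hw hw0 n
  have hm0 : 0 ≤ a m := ha1.trans (le_of_forall_one_le_le_succ hamono le_rfl hm1)
  have hmt : a m ≤ t := (le_of_forall_one_le_le_succ hamono hm1 hmn).trans hn.le
  have hburst : ∑ i ∈ Finset.Icc m (n + 1), len i ≤ c * (t - a m) + σ := by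
    have h1 := sum_Icc_add_tsum_arrivals_le hl hamono hm1 hmn hn hsum
    have h2 := harr (a m) t hm0 hmt
    have h3 : ρ * (t - a m) ≤ c * (t - a m) := by
      gcongr
    rw [hA, hA] at h2
    linarith
  have hburst' : (∑ i ∈ Finset.Icc m (n + 1), len i) / c ≤ t - a m + σ / c := by
    rw [div_le_iff₀ hc, add_mul, div_mul_cancel₀ _ hc.ne']
    linarith
  have hlMc : 0 ≤ lM / c := by positivity
  rw [if_pos hn, if_pos]
  rw [add_div, add_div]
  linarith
end
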